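/- Define 𝒰 = max_j l_j − (1/M)∑_i l_i for logits l ∈ ℝ^M and P the softmax of l. Then 𝒰 − log M ≤ KL(U‖P) ≤ 𝒰, where U is the uniform distribution on M classes. -/

import Mathlib

open Real Finset

/-- The maximum of a finite family is at most its log-sum-exp. -/
theorem sup'_le_log_sum_exp {ι : Type*} {s : Finset ι} (hs : s.Nonempty) (l : ι → ℝ) :
    s.sup' hs l ≤ Real.log (∑ j ∈ s, Real.exp (l j)) := by
  refine Finset.sup'_le hs l fun i hi => ?_
  rw [Real.le_log_iff_exp_le (Finset.sum_pos (fun j _ => Real.exp_pos (l j)) hs)]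
  exact Finset.single_le_sum (f := fun j => Real.exp (l j)) (fun j _ => (Real.exp_pos _).le) hi

/-- The log-sum-exp of a finite family exceeds its maximum by at most the log of its size. -/
theorem log_sum_exp_le_log_card_add_sup' {ι : Type*} {s : Finset ι} (hs : s.Nonempty)
    (l : ι → ℝ) :
    Real.log (∑ j ∈ s, Real.exp (l j)) ≤ Real.log s.card + s.sup' hs l := by
  have hcard : (0 : ℝ) < s.card := Nat.cast_pos.mpr hs.card_pos
  rw [Real.log_le_iff_le_exp (Finset.sum_pos (fun j _ => Real.exp_pos (l j)) hs), Real.exp_add,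
    Real.exp_log hcard, ← nsmul_eq_mul]
  exact Finset.sum_le_card_nsmul _ _ _ fun i hi => Real.exp_le_exp.mpr (Finset.le_sup' l hi)

/-- `𝒰 − log M ≤ KL(U‖P) ≤ 𝒰` where `𝒰 = max_j l_j − (1/M) ∑ l_i` and
`P` is the softmax of `l`. -/
theorem kl_bounds_by_U (M : ℕ) (hM : 1 ≤ M) (l : Fin M → ℝ)
    (hne : (Finset.univ : Finset (Fin M)).Nonempty)
    (P : Fin M → ℝ) (hP : ∀ i, P i = Real.exp (l i) / ∑ j, Real.exp (l j))
    (U : ℝ) (hU : U = Finset.univ.sup' hne l - (1 / (M : ℝ)) * ∑ i, l i)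
    (KL : ℝ) (hKL : KL = ∑ i, (1 / (M : ℝ)) * Real.log ((1 / (M : ℝ)) / P i)) :
    U - Real.log M ≤ KL ∧ KL ≤ U := by
  have hMpos : (0 : ℝ) < M := Nat.cast_pos.mpr hM
  have hS : 0 < ∑ j, Real.exp (l j) := Finset.sum_pos (fun j _ => Real.exp_pos (l j)) hne
  have hlower := sup'_le_log_sum_exp hne l
  have hupper := log_sum_exp_le_log_card_add_sup' hne l
  rw [Finset.card_univ, Fintype.card_fin] at hupper
  have hlog (i : Fin M) : Real.log ((1 / (M : ℝ)) / P i) =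
      Real.log (∑ j, Real.exp (l j)) - Real.log M - l i := by
    rw [hP, Real.log_div (by positivity) (by positivity), one_div, Real.log_inv,
      Real.log_div (Real.exp_ne_zero _) hS.ne', Real.log_exp]
    ring
  have hKL_eq : KL = Real.log (∑ j, Real.exp (l j)) - Real.log M - (1 / (M : ℝ)) * ∑ i, l i := by
    simp only [hKL, hlog, ← Finset.mul_sum, Finset.sum_sub_distrib, Finset.sum_const,
      Finset.card_univ, Fintype.card_fin, nsmul_eq_mul]
    field_simp
  constructor <;> linarith
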